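/- arXiv:math/0410275 — 3 statements merged into one kernel-verified Lean document; each statement's English description precedes it below -/
import Mathlib

section
/- Let M be a Coxeter matrix of finite type. Then every element w of the Coxeter group W(M) with w ^ 2 = 1 lifts to a palindrome in the Artin group: there exists x ∈ A(M) with rev x = x and π x = w. -/
/-- The alternating word `w k (a, b) = a b a b ⋯` (`k` factors) in the free group on `B`. -/
def artinWord {B : Type*} : ℕ → B → B → FreeGroup B
  | 0, _, _ => 1
  | (k + 1), a, b => FreeGroup.of a * artinWord k b a

/-- The Artin relators of a Coxeter matrix `m` : the relators
`w (m i j) (sᵢ, sⱼ) * (w (m i j) (sⱼ, sᵢ))⁻¹` for `i ≠ j` with `m i j ≠ 0`. -/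
def artinRels {B : Type*} (m : B → B → ℕ) : Set (FreeGroup B) :=
  { r | ∃ i j : B, i ≠ j ∧ m i j ≠ 0 ∧
      r = artinWord (m i j) i j * (artinWord (m i j) j i)⁻¹ }

/-- The Artin group of a Coxeter matrix `m`, as a presented group. -/
def ArtinGroup {B : Type*} (m : B → B → ℕ) : Type _ := PresentedGroup (artinRels m)

instance {B : Type*} (m : B → B → ℕ) : Group (ArtinGroup m) :=
  QuotientGroup.Quotient.group _

/-- The Artin generator `s i` of the Artin group. -/
def artinGen {B : Type*} (m : B → B → ℕ) (i : B) : ArtinGroup m := PresentedGroup.of i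

namespace CoxeterMatrix

variable {B : Type*} (M : CoxeterMatrix B)

/-- The `i`-th simple coroot of the geometric representation of `M`, as a linear form on
`B →₀ ℝ`. -/
noncomputable def simpleCoroot (i : B) : Module.Dual ℝ (B →₀ ℝ) :=
  Finsupp.linearCombination ℝ fun j => -2 * Real.cos (Real.pi / M i j)

theorem simpleCoroot_single (i j : B) :
    M.simpleCoroot i (Finsupp.single j 1) = -2 * Real.cos (Real.pi / M i j) := by
  simp [simpleCoroot]

theorem simpleCoroot_single_self (i : B) : M.simpleCoroot i (Finsupp.single i 1) = 2 := by
  simp [simpleCoroot_single]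

/-- The `i`-th simple reflection of the geometric representation of `M`. -/
noncomputable def geomReflection (i : B) : (B →₀ ℝ) ≃ₗ[ℝ] (B →₀ ℝ) :=
  Module.reflection (M.simpleCoroot_single_self i)

theorem simpleCoroot_mul_simpleCoroot (i j : B) :
    2 * Real.cos (2 * Real.pi / M i j) =
      M.simpleCoroot i (Finsupp.single j 1) * M.simpleCoroot j (Finsupp.single i 1) - 2 := by
  rw [simpleCoroot_single, simpleCoroot_single, M.symmetric j i, mul_div_assoc, Real.cos_two_mul]
  ring

theorem sin_two_pi_div_pos {m : ℕ} (hm : 3 ≤ m) : 0 < Real.sin (2 * Real.pi / m) := by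
  have hm' : (3 : ℝ) ≤ m := by exact_mod_cast hm
  have := Real.pi_pos
  apply Real.sin_pos_of_pos_of_lt_pi
  · positivity
  · rw [div_lt_iff₀ (by linarith)]
    nlinarith

theorem geomReflection_mul_self (i : B) : M.geomReflection i * M.geomReflection i = 1 :=
  LinearEquiv.ext <| Module.involutive_reflection (M.simpleCoroot_single_self i)

theorem geomReflection_isLiftable : M.IsLiftable M.geomReflection := by
  intro i j
  obtain h | h | h | h : M i j = 0 ∨ M i j = 1 ∨ M i j = 2 ∨ 3 ≤ M i j := by omega
  · rw [h, pow_zero]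
  · obtain rfl : i = j := by
      by_contra hij
      exact M.off_diagonal i j hij h
    rw [geomReflection_mul_self, one_pow]
  · have h1 : M.simpleCoroot i (Finsupp.single j 1) = 0 := by
      simp [simpleCoroot_single, h]
    have h2 : M.simpleCoroot j (Finsupp.single i 1) = 0 := by
      simp [simpleCoroot_single, M.symmetric j i, h]
    have hc : M.geomReflection i * M.geomReflection j = M.geomReflection j * M.geomReflection i := by
      ext1 z
      simp only [geomReflection, LinearEquiv.mul_apply, Module.reflection_apply, map_sub, map_smul,
        h1, h2]
      module
    rw [h, pow_two]
    nth_rewrite 2 [hc]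
    rw [mul_assoc, ← mul_assoc (M.geomReflection j), geomReflection_mul_self, one_mul,
      geomReflection_mul_self]
  · ext1 z
    have hs := sin_two_pi_div_pos h
    set θ : ℝ := 2 * Real.pi / M i j with hθ
    have hmθ : M i j * θ = 2 * Real.pi := by
      rw [hθ]; field_simp
    have key := Module.reflection_mul_reflection_pow_apply (M.simpleCoroot_single_self i)
      (M.simpleCoroot_single_self j) (M i j) z _ (M.simpleCoroot_mul_simpleCoroot i j)
    rw [← hθ] at key
    change ((Module.reflection (M.simpleCoroot_single_self i) *
      Module.reflection (M.simpleCoroot_single_self j)) ^ M i j) z = z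
    rw [key]
    obtain ⟨l, hl | hl⟩ := Nat.even_or_odd' (M i j)
    · have hS : (Polynomial.Chebyshev.S ℝ (l - 1 : ℤ)).eval (2 * Real.cos θ) = 0 := by
        refine (mul_eq_zero.mp ?_).resolve_right hs.ne'
        rw [Polynomial.Chebyshev.S_two_mul_real_cos]
        have : ((((l : ℤ) - 1 : ℤ) : ℝ) + 1) * θ = Real.pi := by
          rw [hl] at hmθ
          push_cast at hmθ ⊢
          linarith
        rw [this, Real.sin_pi]
      rw [show ((M i j : ℤ) - 2) / 2 = l - 1 by omega, show ((M i j : ℤ) - 1) / 2 = l - 1 by omega,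
        hS]
      simp
    · have hS : (Polynomial.Chebyshev.S ℝ (l : ℤ)).eval (2 * Real.cos θ) +
          (Polynomial.Chebyshev.S ℝ (l - 1 : ℤ)).eval (2 * Real.cos θ) = 0 := by
        refine (mul_eq_zero.mp ?_).resolve_right hs.ne'
        rw [add_mul, Polynomial.Chebyshev.S_two_mul_real_cos,
          Polynomial.Chebyshev.S_two_mul_real_cos]
        have : (((l : ℤ) : ℝ) + 1) * θ = 2 * Real.pi - ((((l : ℤ) - 1 : ℤ) : ℝ) + 1) * θ := by
          rw [hl] at hmθ
          push_cast at hmθ ⊢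
          linarith
        rw [this, Real.sin_two_pi_sub]
        ring
      rw [show ((M i j : ℤ) - 2) / 2 = l - 1 by omega, show ((M i j : ℤ) - 1) / 2 = l by omega,
        show ((M i j : ℤ) - 3) / 2 = l - 1 by omega, show (M i j : ℤ) / 2 = l by omega, hS]
      simp

theorem dvd_of_geomReflection_mul_pow_eq_one {i j : B} (hij : i ≠ j) {k : ℕ}
    (hk : (M.geomReflection i * M.geomReflection j) ^ k = 1) : M i j ∣ k := by
  have key := Module.reflection_mul_reflection_pow_apply_self (M.simpleCoroot_single_self i)
    (M.simpleCoroot_single_self j) k _ (M.simpleCoroot_mul_simpleCoroot i j)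
  change ((M.geomReflection i * M.geomReflection j) ^ k) (Finsupp.single i 1) = _ at key
  rw [hk] at key
  have hi := DFunLike.congr_fun key i
  have hj := DFunLike.congr_fun key j
  simp [hij, hij.symm, simpleCoroot_single, M.symmetric j i] at hi hj
  have h1 := M.off_diagonal i j hij
  obtain h | h | h : M i j = 0 ∨ M i j = 2 ∨ 3 ≤ M i j := by omega
  · simp [h, Polynomial.Chebyshev.S_eval_two] at hj
    simp [hj]
  · have ht : 2 * Real.cos (2 * Real.pi / ((2 : ℕ) : ℝ)) = -2 := by simp
    rw [h, ht, Polynomial.Chebyshev.S_eval_neg_two, Polynomial.Chebyshev.S_eval_neg_two] at hi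
    rw [h, ← even_iff_two_dvd]
    by_contra hodd
    rw [Nat.not_even_iff_odd] at hodd
    have ho : Odd (k : ℤ) := by exact_mod_cast hodd
    have he : Even ((k : ℤ) - 1) := ho.sub_odd odd_one
    rw [Int.negOnePow_odd _ ho, Int.negOnePow_even _ he] at hi
    push_cast at hi
    linarith
  · have hs := sin_two_pi_div_pos h
    have hm0 : (M i j : ℝ) ≠ 0 := by
      have : M i j ≠ 0 := by omega
      exact_mod_cast this
    have hcos : Real.cos (Real.pi / M i j) ≠ 0 := by
      intro h0
      rw [mul_div_assoc, Real.sin_two_mul, h0, mul_zero] at hs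
      exact hs.false
    have hS := hj.resolve_right hcos
    set θ : ℝ := 2 * Real.pi / M i j with hθ
    rw [hS, add_zero] at hi
    have e1 := Polynomial.Chebyshev.S_two_mul_real_cos θ (k - 1)
    have e2 := Polynomial.Chebyshev.S_two_mul_real_cos θ k
    rw [hS, zero_mul] at e1
    rw [← hi, one_mul] at e2
    push_cast at e1 e2
    rw [sub_add_cancel] at e1
    rw [add_mul, one_mul, Real.sin_add, ← e1, zero_mul, zero_add] at e2
    have hc : Real.cos (k * θ) = 1 := by
      field_simp at e2
      exact e2.symm
    obtain ⟨n, hn⟩ := (Real.cos_eq_one_iff _).mp hc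
    have : (n * M i j : ℝ) = k := by
      rw [hθ] at hn
      field_simp at hn
      exact hn
    have hz : (k : ℤ) = M i j * n := by
      rw [mul_comm]
      exact_mod_cast this.symm
    exact_mod_cast Dvd.intro n hz.symm

end CoxeterMatrix

namespace CoxeterSystem

variable {B W : Type*} [Group W] {M : CoxeterMatrix B} (cs : CoxeterSystem M W)

theorem dvd_of_simple_mul_simple_pow_eq_one {i j : B} (hij : i ≠ j) {k : ℕ}
    (hk : (cs.simple i * cs.simple j) ^ k = 1) : M i j ∣ k := by
  apply M.dvd_of_geomReflection_mul_pow_eq_one hij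
  simpa only [map_pow, map_mul, cs.lift_apply_simple, map_one] using
    congrArg (cs.lift ⟨_, M.geomReflection_isLiftable⟩) hk

open Classical in
/-- The action of the simple reflection `i` on `W × ZMod 2`: conjugation on `W`, together with a
sign change at `i` itself. -/
noncomputable def signedConj (i : B) : Function.End (W × ZMod 2) := fun p =>
  (cs.simple i * p.1 * cs.simple i, p.2 + if p.1 = cs.simple i then 1 else 0)

open Classical in
theorem signedConj_mul_pow_apply (i j : B) (k : ℕ) (t : W) (ε : ZMod 2) :
    ((cs.signedConj i * cs.signedConj j) ^ k) (t, ε) =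
      ((cs.simple i * cs.simple j) ^ k * t * ((cs.simple i * cs.simple j) ^ k)⁻¹,
        ε + ∑ l ∈ Finset.range (2 * k),
          if t = (cs.simple j * cs.simple i) ^ l * cs.simple j then 1 else 0) := by
  set a := cs.simple i * cs.simple j with ha
  have hinv : cs.simple j * cs.simple i = a⁻¹ := by simp [ha]
  have hconj (n : ℕ) : cs.simple j * a ^ n = (a ^ n)⁻¹ * cs.simple j := by
    have : cs.simple j * a * (cs.simple j)⁻¹ = a⁻¹ := by simp [ha, mul_assoc]
    rw [← mul_inv_eq_iff_eq_mul, ← conj_pow, this, inv_pow]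
  induction k with
  | zero => simp; rfl
  | succ k ih =>
    rw [pow_succ']
    change cs.signedConj i (cs.signedConj j (((cs.signedConj i * cs.signedConj j) ^ k) (t, ε))) = _
    rw [ih]
    have e1 : (a ^ k * t * (a ^ k)⁻¹ = cs.simple j) ↔
        t = (cs.simple j * cs.simple i) ^ (2 * k) * cs.simple j := by
      rw [mul_inv_eq_iff_eq_mul, hconj, ← eq_inv_mul_iff_mul_eq, hinv, two_mul, pow_add, inv_pow,
        mul_assoc]
    have e2 : (cs.simple j * (a ^ k * t * (a ^ k)⁻¹) * cs.simple j = cs.simple i) ↔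
        t = (cs.simple j * cs.simple i) ^ (2 * k + 1) * cs.simple j := by
      have hj : cs.simple j * (a ^ k * t * (a ^ k)⁻¹) * cs.simple j = cs.simple i ↔
          a ^ k * t * (a ^ k)⁻¹ = cs.simple j * cs.simple i * cs.simple j := by
        constructor
        · intro h
          rw [← h]
          simp [mul_assoc]
        · intro h
          rw [h]
          simp [mul_assoc]
      rw [hj, hinv, mul_inv_eq_iff_eq_mul, mul_assoc a⁻¹, hconj, ← eq_inv_mul_iff_mul_eq]
      have : (a ^ k)⁻¹ * (a⁻¹ * ((a ^ k)⁻¹ * cs.simple j)) = a⁻¹ ^ (2 * k + 1) * cs.simple j := by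
        group
      rw [this]
    simp only [signedConj, e1, e2]
    rw [show 2 * (k + 1) = 2 * k + 1 + 1 by ring, Finset.sum_range_succ, Finset.sum_range_succ]
    refine Prod.ext ?_ ?_
    · simp [ha, pow_succ', mul_assoc]
    · simp [add_assoc]

theorem signedConj_isLiftable : M.IsLiftable cs.signedConj := by
  classical
  intro i j
  funext ⟨t, ε⟩
  rw [signedConj_mul_pow_apply, two_mul, Finset.sum_range_add]
  simp only [pow_add, simple_mul_simple_pow, simple_mul_simple_pow', one_mul, inv_one, mul_one,
    CharTwo.add_self_eq_zero, add_zero]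
  rfl

open Classical in
theorem lift_signedConj_wordProd (ω : List B) (t : W) (ε : ZMod 2) :
    cs.lift ⟨_, cs.signedConj_isLiftable⟩ (cs.wordProd ω) (t, ε) =
      (cs.wordProd ω * t * (cs.wordProd ω)⁻¹, ε + ((cs.rightInvSeq ω).count t : ZMod 2)) := by
  induction ω with
  | nil => simp; rfl
  | cons i ω ih =>
    rw [wordProd_cons, map_mul, lift_apply_simple]
    change cs.signedConj i (cs.lift ⟨_, cs.signedConj_isLiftable⟩ (cs.wordProd ω) (t, ε)) = _
    rw [ih]
    have e : (cs.wordProd ω * t * (cs.wordProd ω)⁻¹ = cs.simple i) ↔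
        (cs.wordProd ω)⁻¹ * cs.simple i * cs.wordProd ω = t := by
      rw [mul_inv_eq_iff_eq_mul, ← eq_inv_mul_iff_mul_eq, eq_comm, mul_assoc]
    refine Prod.ext ?_ ?_
    · simp [signedConj, mul_assoc]
    · simp only [signedConj, rightInvSeq, List.count_cons, e, beq_iff_eq]
      push_cast
      rw [add_assoc]

theorem simple_mem_rightInvSeq_of_isRightDescent {ω : List B} {i : B}
    (h : cs.IsRightDescent (cs.wordProd ω) i) : cs.simple i ∈ cs.rightInvSeq ω := by
  classical
  obtain ⟨ω', hω', e⟩ := cs.exists_isReduced (cs.wordProd ω * cs.simple i)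
  have hnot : cs.simple i ∉ cs.rightInvSeq ω' := by
    intro hmem
    have := (cs.isRightInversion_of_mem_rightInvSeq hω' hmem).2
    rw [← e, simple_mul_simple_cancel_right] at this
    exact lt_asymm h this
  have hω : cs.wordProd ω = cs.wordProd ω' * cs.simple i := by
    rw [← e, simple_mul_simple_cancel_right]
  have key := congrArg Prod.snd (cs.lift_signedConj_wordProd ω (cs.simple i) 0)
  rw [hω, map_mul, lift_apply_simple] at key
  change (cs.lift ⟨_, cs.signedConj_isLiftable⟩ (cs.wordProd ω')
    (cs.signedConj i (cs.simple i, 0))).2 = _ at key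
  have hs : cs.signedConj i (cs.simple i, 0) = (cs.simple i, 1) := by simp [signedConj]
  rw [hs, lift_signedConj_wordProd, List.count_eq_zero_of_not_mem hnot] at key
  by_contra hmem
  rw [List.count_eq_zero_of_not_mem hmem] at key
  simp at key

theorem simple_mem_leftInvSeq_of_isLeftDescent {ω : List B} {i : B}
    (h : cs.IsLeftDescent (cs.wordProd ω) i) : cs.simple i ∈ cs.leftInvSeq ω := by
  have := cs.simple_mem_rightInvSeq_of_isRightDescent (ω := ω.reverse) (i := i)
    (by rwa [wordProd_reverse, isRightDescent_inv_iff])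
  rwa [rightInvSeq_reverse, List.mem_reverse] at this

/-- The alternating word `i j i j ⋯` with `k` letters, starting with `i`. -/
def alternatingWordFrom : ℕ → B → B → List B
  | 0, _, _ => []
  | k + 1, i, j => i :: alternatingWordFrom k j i

@[simp] theorem length_alternatingWordFrom (k : ℕ) (i j : B) :
    (alternatingWordFrom k i j).length = k := by
  induction k generalizing i j with
  | zero => rfl
  | succ k ih => simp [alternatingWordFrom, ih]

theorem getElem_leftInvSeq_alternatingWordFrom_append {k p : ℕ} (hp : p < k) (i j : B)
    (c : List B) (h : p < (cs.leftInvSeq (alternatingWordFrom k i j ++ c)).length) :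
    (cs.leftInvSeq (alternatingWordFrom k i j ++ c))[p] =
      (cs.simple i * cs.simple j) ^ p * cs.simple i := by
  induction k generalizing p i j with
  | zero => omega
  | succ k ih =>
    cases p with
    | zero => simp [alternatingWordFrom, leftInvSeq]
    | succ p =>
      simp only [alternatingWordFrom, List.cons_append, leftInvSeq, List.getElem_cons_succ,
        List.getElem_map, ih (show p < k by omega), MulAut.conj_apply, inv_simple]
      have hcomm : SemiconjBy (cs.simple i) (cs.simple j * cs.simple i)
          (cs.simple i * cs.simple j) := (mul_assoc _ _ _).symm
      rw [← mul_assoc, (hcomm.pow_right p).eq, pow_succ]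
      simp only [mul_assoc]

theorem alternatingWordFrom_eq (k : ℕ) (i j : B) :
    alternatingWordFrom k i j = if Even k then alternatingWord i j k else alternatingWord j i k := by
  induction k generalizing i j with
  | zero => rfl
  | succ k ih =>
    by_cases hk : Even k <;>
      simp [alternatingWordFrom, ih, hk, alternatingWord_succ', Nat.even_add_one]

theorem wordProd_alternatingWordFrom_eq (i j : B) :
    cs.wordProd (alternatingWordFrom (M i j) i j) =
      cs.wordProd (alternatingWordFrom (M i j) j i) := by
  have h := cs.wordProd_braidWord_eq i j
  rw [braidWord, braidWord, M.symmetric j i] at h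
  rw [alternatingWordFrom_eq, alternatingWordFrom_eq]
  split_ifs
  · exact h
  · exact h.symm

theorem exists_eq_wordProd_alternatingWordFrom_append {w : W} {i j : B} (hij : i ≠ j)
    (hi : cs.IsLeftDescent w i) (hj : cs.IsLeftDescent w j) (k : ℕ) (hk : M i j ≠ 0 → k ≤ M i j) :
    ∃ c : List B, w = cs.wordProd (alternatingWordFrom k i j ++ c) ∧
      k + c.length = cs.length w := by
  induction k generalizing i j with
  | zero =>
    obtain ⟨c, hc, rfl⟩ := cs.exists_isReduced w
    exact ⟨c, rfl, by simp [hc.eq]⟩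
  | succ k ih =>
    obtain ⟨c, hw, hlen⟩ := ih hij.symm hj hi fun h => by
      rw [M.symmetric j i] at h ⊢
      exact (Nat.le_succ k).trans (hk h)
    have hmem := cs.simple_mem_leftInvSeq_of_isLeftDescent (hw ▸ hi)
    obtain ⟨p, hp, hpi⟩ := List.mem_iff_getElem.mp hmem
    have hpk : k ≤ p := by
      by_contra! hlt
      rw [getElem_leftInvSeq_alternatingWordFrom_append _ hlt] at hpi
      have hpow : (cs.simple j * cs.simple i) ^ (p + 1) = 1 := by
        rw [pow_succ, ← mul_assoc, hpi, simple_mul_simple_self]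
      have hdvd := cs.dvd_of_simple_mul_simple_pow_eq_one hij.symm hpow
      rw [M.symmetric j i] at hdvd
      have hle := Nat.le_of_dvd p.succ_pos hdvd
      have := hk fun h0 => by simp [h0] at hdvd
      omega
    have hdel := cs.getD_leftInvSeq_mul_wordProd (alternatingWordFrom k j i ++ c) p
    rw [List.getD_eq_getElem _ _ hp, hpi, ← hw, List.eraseIdx_append_of_length_le (by simpa)] at hdel
    rw [length_leftInvSeq] at hp
    refine ⟨c.eraseIdx (p - k), ?_, ?_⟩
    · rw [alternatingWordFrom, List.cons_append, wordProd_cons]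
      simp only [length_alternatingWordFrom] at hdel
      rw [← hdel, simple_mul_simple_cancel_left]
    · simp only [List.length_append, length_alternatingWordFrom] at hp
      rw [← hlen, ← List.length_eraseIdx_add_one (l := c) (i := p - k) (by omega)]
      ring

/-- **Matsumoto's theorem**: a map to a monoid that satisfies the braid relations takes the same
value on any two reduced words of the same element. -/
theorem prod_map_eq_of_isReduced {G : Type*} [Monoid G] {g : B → G}
    (hg : ∀ i j, i ≠ j → M i j ≠ 0 → ((alternatingWordFrom (M i j) i j).map g).prod =
      ((alternatingWordFrom (M i j) j i).map g).prod)
    {ω ω' : List B} (hω : cs.IsReduced ω) (hω' : cs.IsReduced ω')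
    (h : cs.wordProd ω = cs.wordProd ω') : (ω.map g).prod = (ω'.map g).prod := by
  obtain ⟨n, hn⟩ : ∃ n, ω.length = n := ⟨_, rfl⟩
  induction n generalizing ω ω' with
  | zero =>
    have hn' : ω'.length = 0 := by rw [← hω'.eq, ← h, hω.eq, hn]
    rw [List.length_eq_zero_iff.mp hn, List.length_eq_zero_iff.mp hn']
  | succ n ih =>
    have hn' : ω'.length = n + 1 := by rw [← hω'.eq, ← h, hω.eq, hn]
    have same (i : B) {a b : List B} (ha : cs.IsReduced (i :: a)) (hb : cs.IsReduced (i :: b))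
        (hab : cs.wordProd (i :: a) = cs.wordProd (i :: b)) (hla : (i :: a).length = n + 1) :
        ((i :: a).map g).prod = ((i :: b).map g).prod := by
      rw [wordProd_cons, wordProd_cons, mul_right_inj] at hab
      simp only [List.map_cons, List.prod_cons]
      rw [ih (by simpa using ha.drop 1) (by simpa using hb.drop 1) hab (by simpa using hla)]
    have desc (i : B) {a : List B} (ha : cs.IsReduced (i :: a)) :
        cs.IsLeftDescent (cs.wordProd (i :: a)) i := by
      rw [IsLeftDescent, ha.eq, wordProd_cons, simple_mul_simple_cancel_left]
      exact (cs.length_wordProd_le a).trans_lt (by simp)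
    obtain ⟨i, a, rfl⟩ := List.exists_cons_of_length_eq_add_one hn
    obtain ⟨j, b, rfl⟩ := List.exists_cons_of_length_eq_add_one hn'
    by_cases hij : i = j
    · subst hij
      exact same i hω hω' h hn
    · have hi := desc i hω
      have hj := desc j hω'
      rw [← h] at hj
      have hm : M i j ≠ 0 := by
        intro h0
        obtain ⟨c, -, hc⟩ := cs.exists_eq_wordProd_alternatingWordFrom_append hij hi hj
          (n + 2) fun h => absurd h0 h
        rw [hω.eq, hn] at hc
        omega
      obtain ⟨c, hc, hcl⟩ := cs.exists_eq_wordProd_alternatingWordFrom_append hij hi hj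
        (M i j) fun _ => le_rfl
      have hbraid := hg i j hij hm
      have hlen (x y : B) : (alternatingWordFrom (M i j) x y ++ c).length = n + 1 := by
        rw [List.length_append, length_alternatingWordFrom, hcl, hω.eq, hn]
      have hc' := hc
      rw [wordProd_append, wordProd_alternatingWordFrom_eq, ← wordProd_append] at hc'
      have hred {d : List B} (hd : cs.wordProd (i :: a) = cs.wordProd d) (hdl : d.length = n + 1) :
          cs.IsReduced d := by
        rw [IsReduced, ← hd, hω.eq, hn, hdl]
      have hred₁ := hred hc (hlen i j)
      have hred₂ := hred hc' (hlen j i)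
      have hl₂ := hlen j i
      rw [h] at hc'
      have hprod : ((alternatingWordFrom (M i j) i j ++ c).map g).prod =
          ((alternatingWordFrom (M i j) j i ++ c).map g).prod := by
        rw [List.map_append, List.map_append, List.prod_append, List.prod_append, hbraid]
      obtain ⟨m, hm⟩ := Nat.exists_eq_succ_of_ne_zero hm
      rw [hm] at hc hc' hred₁ hred₂ hl₂ hprod
      exact (same i hω hred₁ hc hn).trans
        (hprod.trans (same j hred₂ hω' hc'.symm hl₂))

end CoxeterSystem

theorem artinWord_eq_prod {B : Type*} (k : ℕ) (i j : B) :
    artinWord k i j = ((CoxeterSystem.alternatingWordFrom k i j).map FreeGroup.of).prod := by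
  induction k generalizing i j with
  | zero => rfl
  | succ k ih => simp [artinWord, CoxeterSystem.alternatingWordFrom, ih]

theorem prod_map_artinGen_alternatingWordFrom {B : Type*} (m : B → B → ℕ) {i j : B} (hij : i ≠ j)
    (hm : m i j ≠ 0) :
    ((CoxeterSystem.alternatingWordFrom (m i j) i j).map (artinGen m)).prod =
      ((CoxeterSystem.alternatingWordFrom (m i j) j i).map (artinGen m)).prod := by
  have hmk (ω : List B) : PresentedGroup.mk (artinRels m) ((ω.map FreeGroup.of).prod) =
      (ω.map (artinGen m)).prod := by
    rw [map_list_prod, List.map_map]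
    rfl
  have hrel : PresentedGroup.mk (artinRels m)
      (artinWord (m i j) i j * (artinWord (m i j) j i)⁻¹) = 1 :=
    PresentedGroup.one_of_mem ⟨i, j, hij, hm, rfl⟩
  rw [map_mul, map_inv, mul_inv_eq_one, artinWord_eq_prod, artinWord_eq_prod, hmk, hmk] at hrel
  exact hrel

theorem rev_prod_map_artinGen {B : Type*} {m : B → B → ℕ} {rev : ArtinGroup m → ArtinGroup m}
    (hmul : ∀ x y, rev (x * y) = rev y * rev x)
    (hgen : ∀ i : B, rev (artinGen m i) = artinGen m i) (ω : List B) :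
    rev (ω.map (artinGen m)).prod = (ω.reverse.map (artinGen m)).prod := by
  induction ω with
  | nil => simpa using hmul 1 1
  | cons i ω ih => simp [hmul, hgen, ih]

/-- Let `M` be a Coxeter matrix of finite type.  Every element `w` of the
Coxeter group `W(M)` with `w ^ 2 = 1` lifts to a palindrome in the Artin group: there is
`x ∈ A(M)` with `rev x = x` and `π x = w`. -/
theorem involution_lifts_to_palindrome
    {B : Type*} (M : CoxeterMatrix B) [Finite M.Group]
    (rev : ArtinGroup (fun i j => M i j) → ArtinGroup (fun i j => M i j))
    (hmul : ∀ x y, rev (x * y) = rev y * rev x)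
    (hinv : ∀ x, rev (rev x) = x)
    (hgen : ∀ i : B, rev (artinGen (fun i j => M i j) i) = artinGen (fun i j => M i j) i)
    (π : ArtinGroup (fun i j => M i j) →* M.Group)
    (hπ : ∀ i : B, π (artinGen (fun i j => M i j) i) = M.simple i)
    (w : M.Group) (hw : w ^ 2 = 1) :
    ∃ x : ArtinGroup (fun i j => M i j), rev x = x ∧ π x = w := by
  let cs := M.toCoxeterSystem
  have hproj (ω : List B) : π (ω.map (artinGen fun i j => M i j)).prod = cs.wordProd ω := by
    rw [map_list_prod, List.map_map]
    exact congrArg List.prod (List.map_congr_left fun i _ => hπ i)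
  obtain ⟨ω, hω, rfl⟩ := cs.exists_isReduced w
  refine ⟨(ω.map (artinGen fun i j => M i j)).prod, ?_, hproj ω⟩
  rw [rev_prod_map_artinGen hmul hgen]
  refine cs.prod_map_eq_of_isReduced
    (fun i j hij hm => prod_map_artinGen_alternatingWordFrom (fun i j => M i j) hij hm)
    hω.reverse hω ?_
  rw [cs.wordProd_reverse, inv_eq_iff_mul_eq_one, ← pow_two, hw]
end

section
/- Let n ≥ 2 and let B n⁺ denote the submonoid of B n generated by σ 1, …, σ (n−1). If x ∈ B n⁺ is a palindrome (rev x = x), then there exist y ∈ B n⁺ and a finite set I of indices in {1, …, n−1} with |i − j| ≥ 2 for all distinct i, j ∈ I, such that x = y * (∏_{i ∈ I} σ i) * rev y. -/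
/-- The braid relators on `n` strands: `σᵢσⱼσᵢ = σⱼσᵢσⱼ` when `|i−j| = 1` and
`σᵢσⱼ = σⱼσᵢ` when `|i−j| ≥ 2`. -/
def braidRels (n : ℕ) : Set (FreeGroup (Fin (n - 1))) :=
  { r | ∃ i j : Fin (n - 1),
      ((i : ℕ) + 1 = (j : ℕ) ∧
        r = (FreeGroup.of i * FreeGroup.of j * FreeGroup.of i) *
            (FreeGroup.of j * FreeGroup.of i * FreeGroup.of j)⁻¹) ∨
      ((i : ℕ) + 2 ≤ (j : ℕ) ∧
        r = (FreeGroup.of i * FreeGroup.of j) * (FreeGroup.of j * FreeGroup.of i)⁻¹) }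

/-- The braid group on `n` strands, as a presented group on `n - 1` generators. -/
def BraidGroup (n : ℕ) : Type := PresentedGroup (braidRels n)

instance (n : ℕ) : Group (BraidGroup n) := QuotientGroup.Quotient.group _

/-- The Artin generator `σ i` of the braid group (here `i : Fin (n-1)` corresponds to the
classical generator `σ_{i+1}`). -/
def braidGen {n : ℕ} (i : Fin (n - 1)) : BraidGroup n := PresentedGroup.of i

/-- The defining relations of the positive braid monoid on countably many strands. -/
inductive ArtinRel : FreeMonoid ℕ → FreeMonoid ℕ → Prop
  | braid (i : ℕ) : ArtinRel (.of i * .of (i + 1) * .of i) (.of (i + 1) * .of i * .of (i + 1))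
  | comm (i j : ℕ) (h : i + 2 ≤ j) : ArtinRel (.of i * .of j) (.of j * .of i)

/-- The positive braid monoid on countably many strands. -/
abbrev PosBraid : Type := PresentedMonoid ArtinRel

namespace PosBraid

/-- The generators of the positive braid monoid. -/
def σ (i : ℕ) : PosBraid := PresentedMonoid.of ArtinRel i

/-- The generators `σ s` and `σ t` satisfy the braid relation of length three. -/
def Adj (s t : ℕ) : Prop := s + 1 = t ∨ t + 1 = s

/-- The generators `σ s` and `σ t` commute by a defining relation. -/
def Far (s t : ℕ) : Prop := s + 2 ≤ t ∨ t + 2 ≤ s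

theorem Adj.symm {s t : ℕ} (h : Adj s t) : Adj t s := Or.symm h

theorem Far.symm {s t : ℕ} (h : Far s t) : Far t s := Or.symm h

theorem eq_or_adj_or_far (s t : ℕ) : s = t ∨ Adj s t ∨ Far s t := by
  unfold Adj Far; omega

theorem Adj.far {r s t : ℕ} (hs : Adj r s) (ht : Adj r t) (h : s ≠ t) : Far s t := by
  unfold Adj Far at *; omega

theorem σ_braid {s t : ℕ} (h : Adj s t) : σ s * σ t * σ s = σ t * σ s * σ t := by
  rcases h with rfl | rfl
  · exact PresentedMonoid.mk_eq_mk_of_rel (.braid s)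
  · exact (PresentedMonoid.mk_eq_mk_of_rel (.braid t)).symm

theorem σ_comm {s t : ℕ} (h : Far s t) : σ s * σ t = σ t * σ s := by
  rcases h with h | h
  · exact PresentedMonoid.mk_eq_mk_of_rel (.comm s t h)
  · exact (PresentedMonoid.mk_eq_mk_of_rel (.comm t s h)).symm

theorem σ_braid_mul {s t : ℕ} (h : Adj s t) (x : PosBraid) :
    σ s * (σ t * (σ s * x)) = σ t * (σ s * (σ t * x)) := by
  simpa only [mul_assoc] using congrArg (· * x) (σ_braid h)

theorem σ_comm_mul {s t : ℕ} (h : Far s t) (x : PosBraid) :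
    σ s * (σ t * x) = σ t * (σ s * x) := by
  simpa only [mul_assoc] using congrArg (· * x) (σ_comm h)

/-- Induction on positive braids by multiplying with generators from the left. -/
theorem induction_left {p : PosBraid → Prop} (x : PosBraid) (one : p 1)
    (mul : ∀ i x, p x → p (σ i * x)) : p x := by
  induction x using PresentedMonoid.inductionOn with | _ w
  induction w using FreeMonoid.inductionOn' with
  | one => exact one
  | of_mul i w ih => exact mul i _ ih

open Classical in
/-- The right complement: `σ s * compl s t` is the least common right multiple of `σ s`, `σ t`. -/
noncomputable def compl (s t : ℕ) : PosBraid :=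
  if s = t then 1 else if Adj s t then σ t * σ s else σ t

theorem compl_self (s : ℕ) : compl s s = 1 := by simp [compl]

theorem compl_adj {s t : ℕ} (h : Adj s t) : compl s t = σ t * σ s := by
  have : s ≠ t := by unfold Adj at h; omega
  simp [compl, this, h]

theorem compl_far {s t : ℕ} (h : Far s t) : compl s t = σ t := by
  have h₁ : s ≠ t := by unfold Far at h; omega
  have h₂ : ¬ Adj s t := by unfold Far at h; unfold Adj; omega
  simp [compl, h₁, h₂]

theorem σ_mul_compl_comm {r s t : ℕ} (hs : Far r s) (ht : Far r t) :
    σ r * compl s t = compl s t * σ r := by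
  rcases eq_or_adj_or_far s t with rfl | h | h
  · rw [compl_self, one_mul, mul_one]
  · rw [compl_adj h, mul_assoc, ← σ_comm hs, ← mul_assoc, σ_comm ht, mul_assoc]
  · rw [compl_far h, σ_comm ht]

/-- The word length on the positive braid monoid. -/
def len : PosBraid →* Multiplicative ℕ :=
  PresentedMonoid.lift (fun _ => .ofAdd 1) (by rintro _ _ (⟨i⟩ | ⟨i, j, h⟩) <;> rfl)

/-- The length of a positive braid, as a natural number. -/
def length (x : PosBraid) : ℕ := (len x).toAdd

@[simp] theorem length_one : length 1 = 0 := by simp [length]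

@[simp] theorem length_mul (x y : PosBraid) : length (x * y) = length x + length y := by
  simp [length]

@[simp] theorem length_σ (i : ℕ) : length (σ i) = 1 := rfl

/-- The divisibility property of `a`, `b` in an equation `σ s * a = σ t * b`. -/
def Factors (s t : ℕ) (a b : PosBraid) : Prop := ∃ c, a = compl s t * c ∧ b = compl t s * c

theorem Factors.symm {s t : ℕ} {a b : PosBraid} (h : Factors s t a b) : Factors t s b a := by
  obtain ⟨c, h₁, h₂⟩ := h
  exact ⟨c, h₂, h₁⟩

theorem factors_adj {s t : ℕ} (h : Adj s t) {a b : PosBraid} :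
    Factors s t a b ↔ ∃ c, a = σ t * (σ s * c) ∧ b = σ s * (σ t * c) := by
  simp only [Factors, compl_adj h, compl_adj h.symm, mul_assoc]

theorem factors_far {s t : ℕ} (h : Far s t) {a b : PosBraid} :
    Factors s t a b ↔ ∃ c, a = σ t * c ∧ b = σ s * c := by
  simp only [Factors, compl_far h, compl_far h.symm]

theorem factors_self {s : ℕ} {a b : PosBraid} : Factors s s a b ↔ a = b := by
  simp only [Factors, compl_self, one_mul]
  exact ⟨by rintro ⟨c, rfl, rfl⟩; rfl, fun h => ⟨a, rfl, h.symm⟩⟩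

/-- Garside's divisibility property for all equations between braids of length at most `l`. -/
def FactorsBelow (l : ℕ) : Prop :=
  ∀ s t a b, length a < l → σ s * a = σ t * b → Factors s t a b

theorem FactorsBelow.cancel {l : ℕ} (H : FactorsBelow l) {s : ℕ} {a b : PosBraid}
    (ha : length a < l) (h : σ s * a = σ s * b) : a = b :=
  factors_self.1 (H s s a b ha h)

/-- The case of `Factors.trans` in which the middle generator is adjacent to exactly one of the
outer ones. -/
theorem Factors.trans_adj_far {l : ℕ} (H : FactorsBelow l) {r s t : ℕ} {a e b : PosBraid}
    (he : length e ≤ l) (hs : Adj r s) (ht : Far r t) (h₁ : Factors s r a e)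
    (h₂ : Factors r t e b) : Factors s t a b := by
  obtain ⟨p, rfl, rfl⟩ := (factors_adj hs.symm).1 h₁
  obtain ⟨q, hq, rfl⟩ := (factors_far ht).1 h₂
  simp only [length_mul, length_σ] at he
  have h := H _ _ _ _ (by simp; omega) hq
  rcases eq_or_adj_or_far s t with rfl | hst | hst
  · unfold Adj at hs; unfold Far at ht; omega
  · obtain ⟨c, hc, rfl⟩ := (factors_adj hst).1 h
    have hlen := congrArg length hc
    simp only [length_mul, length_σ] at hlen
    obtain ⟨c', rfl, hc'⟩ := (factors_far ht).1 (H _ _ _ _ (by omega) hc)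
    simp only [length_mul, length_σ] at hlen he
    obtain ⟨d, rfl, rfl⟩ := (factors_adj hs.symm).1 (H _ _ _ _ (by omega) hc')
    refine (factors_adj hst).2 ⟨σ r * (σ s * (σ t * d)), ?_, ?_⟩
    · rw [σ_braid_mul hst, σ_comm_mul ht, ← σ_comm_mul ht d, σ_braid_mul hs]
    · rw [← σ_comm_mul ht, σ_braid_mul hs, σ_braid_mul hst, σ_comm_mul ht]
  · obtain ⟨c, hc, rfl⟩ := (factors_far hst).1 h
    obtain ⟨c', rfl, rfl⟩ := (factors_far ht).1 (H _ _ _ _ (by omega) hc)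
    refine (factors_far hst).2 ⟨σ r * (σ s * c'), ?_, ?_⟩
    · rw [σ_comm_mul hst, σ_comm_mul ht]
    · rw [σ_braid_mul hs]

/-- The case of `Factors.trans` in which the middle generator is adjacent to both outer ones. -/
theorem Factors.trans_adj_adj {l : ℕ} (H : FactorsBelow l) {r s t : ℕ} {a e b : PosBraid}
    (he : length e ≤ l) (hs : Adj r s) (ht : Adj r t) (hst : s ≠ t) (h₁ : Factors s r a e)
    (h₂ : Factors r t e b) : Factors s t a b := by
  have hf := hs.far ht hst
  obtain ⟨p, rfl, rfl⟩ := (factors_adj hs.symm).1 h₁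
  obtain ⟨q, hq, rfl⟩ := (factors_adj ht).1 h₂
  simp only [length_mul, length_σ] at he
  obtain ⟨c, hc₁, hc₂⟩ := (factors_far hf).1 (H _ _ _ _ (by simp; omega) hq)
  have hl₁ := congrArg length hc₁
  have hl₂ := congrArg length hc₂
  simp only [length_mul, length_σ] at hl₁ hl₂
  obtain ⟨c₁, rfl, hc⟩ := (factors_adj ht).1 (H _ _ _ _ (by omega) hc₁)
  obtain ⟨c₂, rfl, rfl⟩ := (factors_adj hs).1 (H _ _ _ _ (by omega) hc₂)
  simp only [length_mul, length_σ] at hl₁ hl₂ he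
  replace hc := H.cancel (by simp only [length_mul, length_σ]; omega) hc
  obtain ⟨c, rfl, rfl⟩ := (factors_far hf).1 (H _ _ _ _ (by omega) hc)
  refine (factors_far hf).2 ⟨σ r * (σ t * (σ s * (σ r * c))), ?_, ?_⟩
  · rw [σ_comm_mul hf, ← σ_braid_mul hs, σ_braid_mul ht]
  · rw [← σ_comm_mul hf, ← σ_braid_mul ht, σ_braid_mul hs, σ_comm_mul hf]

theorem Factors.trans {l : ℕ} (H : FactorsBelow l) {r s t : ℕ} {a e b : PosBraid}
    (he : length e ≤ l) (h₁ : Factors s r a e) (h₂ : Factors r t e b) : Factors s t a b := by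
  by_cases hst : s = t
  · subst hst
    obtain ⟨p, rfl, rfl⟩ := h₁
    obtain ⟨q, hq, rfl⟩ := h₂
    rcases eq_or_adj_or_far r s with rfl | h | h
    · simpa [compl_self, factors_self] using hq
    · simp only [compl_adj h, mul_assoc, length_mul, length_σ] at hq he
      have := H.cancel (by simp; omega) hq
      rw [factors_self, H.cancel (by omega) this]
    · simp only [compl_far h, length_mul, length_σ] at hq he
      rw [factors_self, H.cancel (by omega) hq]
  rcases eq_or_adj_or_far r s with rfl | hs | hs
  · rwa [factors_self.1 h₁]
  · rcases eq_or_adj_or_far r t with rfl | ht | ht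
    · rwa [← factors_self.1 h₂]
    · exact h₁.trans_adj_adj H he hs ht hst h₂
    · exact h₁.trans_adj_far H he hs ht h₂
  · rcases eq_or_adj_or_far r t with rfl | ht | ht
    · rwa [← factors_self.1 h₂]
    · exact (h₂.symm.trans_adj_far H he ht hs h₁.symm).symm
    · obtain ⟨p, rfl, rfl⟩ := (factors_far hs.symm).1 h₁
      obtain ⟨q, hq, rfl⟩ := (factors_far ht).1 h₂
      simp only [length_mul, length_σ] at he
      obtain ⟨c, rfl, rfl⟩ := H _ _ _ _ (by omega) hq
      refine ⟨σ r * c, ?_, ?_⟩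
      · rw [← mul_assoc, σ_mul_compl_comm hs ht, mul_assoc]
      · rw [← mul_assoc, σ_mul_compl_comm ht hs, mul_assoc]

theorem length_mk (w : FreeMonoid ℕ) : length (PresentedMonoid.mk ArtinRel w) = w.length := by
  induction w using FreeMonoid.inductionOn' with
  | one => simp
  | of_mul i w ih =>
    rw [map_mul, length_mul, ih, FreeMonoid.length_mul]
    rfl

/-- The relation on words that compares the tails of two words by means of `Factors`. -/
def WordFactors : List ℕ → List ℕ → Prop
  | [], [] => True
  | s :: a, t :: b =>
    Factors s t (PresentedMonoid.mk _ (.ofList a)) (PresentedMonoid.mk _ (.ofList b))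
  | _, _ => False

theorem WordFactors.refl (u : List ℕ) : WordFactors u u := by
  cases u
  · trivial
  · exact factors_self.2 rfl

theorem WordFactors.symm {u v : List ℕ} (h : WordFactors u v) : WordFactors v u := by
  cases u <;> cases v <;> first | trivial | exact h | exact Factors.symm h

theorem WordFactors.trans {l : ℕ} (H : FactorsBelow l) {u v w : List ℕ}
    (hv : v.length ≤ l + 1) (h₁ : WordFactors u v) (h₂ : WordFactors v w) : WordFactors u w := by
  cases u <;> cases v <;> cases w <;> first | trivial | exact h₁.elim | exact h₂.elim | skip
  refine Factors.trans H ?_ h₁ h₂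
  rw [length_mk]
  exact Nat.le_of_succ_le_succ hv

theorem WordFactors.append {u v w z : List ℕ} (h₁ : WordFactors u v) (h₂ : WordFactors w z)
    (h : PresentedMonoid.mk ArtinRel (.ofList w) = PresentedMonoid.mk ArtinRel (.ofList z)) :
    WordFactors (u ++ w) (v ++ z) := by
  cases u <;> cases v <;> first | exact h₁.elim | exact h₂ | skip
  obtain ⟨c, hc₁, hc₂⟩ := h₁
  refine ⟨c * PresentedMonoid.mk ArtinRel (.ofList w), ?_, ?_⟩
  · rw [← mul_assoc, ← hc₁, ← map_mul]
    rfl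
  · rw [← mul_assoc, ← hc₂, h, ← map_mul]
    rfl

theorem wordFactors_of_rel {l : ℕ} (H : FactorsBelow l) {u v : FreeMonoid ℕ}
    (h : ConGen.Rel ArtinRel u v) :
    u.length = v.length ∧ (u.length ≤ l + 1 → WordFactors u.toList v.toList) := by
  induction h with
  | of u v h =>
    rcases h with ⟨i⟩ | ⟨i, j, h⟩
    · refine ⟨rfl, fun _ => (factors_adj (Or.inl rfl)).2 ⟨1, ?_, ?_⟩⟩ <;> rw [mul_one] <;> rfl
    · refine ⟨rfl, fun _ => (factors_far (Or.inl h)).2 ⟨1, ?_, ?_⟩⟩ <;> rw [mul_one] <;> rfl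
  | refl u => exact ⟨rfl, fun _ => .refl _⟩
  | symm h ih => exact ⟨ih.1.symm, fun hl => (ih.2 (ih.1.trans_le hl)).symm⟩
  | trans h₁ h₂ ih₁ ih₂ =>
    refine ⟨ih₁.1.trans ih₂.1, fun hl => ?_⟩
    have hl' := ih₁.1.symm.trans_le hl
    exact (ih₁.2 hl).trans H hl' (ih₂.2 hl')
  | mul h₁ h₂ ih₁ ih₂ =>
    simp only [FreeMonoid.length_mul, FreeMonoid.toList_mul]
    refine ⟨by rw [ih₁.1, ih₂.1], fun hl => ?_⟩
    exact (ih₁.2 (by omega)).append (ih₂.2 (by omega)) (PresentedMonoid.mk_eq_mk_iff.2 h₂)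

theorem factorsBelow (l : ℕ) : FactorsBelow l := by
  induction l with
  | zero => intro s t a b h; omega
  | succ l ih =>
    intro s t a b ha h
    induction a using PresentedMonoid.inductionOn with | _ a
    induction b using PresentedMonoid.inductionOn with | _ b
    have h' : PresentedMonoid.mk ArtinRel (.of s * a) = PresentedMonoid.mk ArtinRel (.of t * b) := h
    rw [length_mk] at ha
    refine (wordFactors_of_rel ih (PresentedMonoid.mk_eq_mk_iff.1 h')).2 ?_
    rw [FreeMonoid.length_mul, FreeMonoid.length_of]
    omega

/-- Garside's divisibility property of the positive braid monoid. -/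
theorem factors {s t : ℕ} {a b : PosBraid} (h : σ s * a = σ t * b) : Factors s t a b :=
  factorsBelow (length a + 1) s t a b (Nat.lt_succ_self _) h

theorem mul_left_cancel_pos (x : PosBraid) {a b : PosBraid} (h : x * a = x * b) : a = b := by
  induction x using induction_left with
  | one => simpa using h
  | mul i x ih =>
    rw [mul_assoc, mul_assoc] at h
    exact ih (factors_self.1 (factors h))

/-- Word reversal on the positive braid monoid, as a homomorphism to the opposite monoid. -/
def revHom : PosBraid →* PosBraidᵐᵒᵖ :=
  PresentedMonoid.lift (fun i => .op (σ i)) (by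
    rintro _ _ (⟨i⟩ | ⟨i, j, h⟩) <;> simp only [map_mul, FreeMonoid.lift_eval_of] <;>
      apply MulOpposite.unop_injective
    · simpa [mul_assoc] using σ_braid (Or.inl rfl : Adj i (i + 1))
    · simpa using (σ_comm (Or.inl h)).symm)

/-- Word reversal on the positive braid monoid. -/
def rev (x : PosBraid) : PosBraid := (revHom x).unop

@[simp] theorem rev_one : rev 1 = 1 := by simp [rev]

@[simp] theorem rev_mul (x y : PosBraid) : rev (x * y) = rev y * rev x := by simp [rev]

@[simp] theorem rev_σ (i : ℕ) : rev (σ i) = σ i := rfl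

@[simp] theorem rev_rev (x : PosBraid) : rev (rev x) = x := by
  induction x using induction_left with
  | one => simp
  | mul i x ih => simp [ih]

theorem mul_right_cancel_pos (x : PosBraid) {a b : PosBraid} (h : a * x = b * x) : a = b := by
  have := congrArg rev h
  rw [rev_mul, rev_mul] at this
  simpa using congrArg rev (mul_left_cancel_pos _ this)

theorem eq_one_or_exists_mul_σ (x : PosBraid) : x = 1 ∨ ∃ y i, x = y * σ i := by
  induction x using induction_left with
  | one => exact .inl rfl
  | mul i x ih =>
    rcases ih with rfl | ⟨y, j, rfl⟩
    · exact .inr ⟨1, i, by simp⟩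
    · exact .inr ⟨σ i * y, j, by rw [mul_assoc]⟩

/-- The submonoid generated by the first `m` generators. -/
def below (m : ℕ) : Submonoid PosBraid := Submonoid.closure (σ '' Set.Iio m)

theorem σ_mem_below {k m : ℕ} (h : k < m) : σ k ∈ below m :=
  Submonoid.subset_closure ⟨k, h, rfl⟩

theorem below_mono {m n : ℕ} (h : m ≤ n) : below m ≤ below n :=
  Submonoid.closure_mono (Set.image_mono (Set.Iio_subset_Iio h))

theorem exists_mem_below (x : PosBraid) : ∃ m, x ∈ below m := by
  induction x using induction_left with
  | one => exact ⟨0, one_mem _⟩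
  | mul i x ih =>
    obtain ⟨m, hm⟩ := ih
    exact ⟨max m (i + 1), mul_mem (σ_mem_below (by simp)) (below_mono (by simp) hm)⟩

open Classical in
/-- The indicator function of the submonoid `below m`. -/
noncomputable def belowIndicator (m : ℕ) : PosBraid →* ℕ :=
  PresentedMonoid.lift (fun k => if k < m then 1 else 0) (by
    rintro _ _ (⟨i⟩ | ⟨i, j, h⟩) <;> simp only [map_mul, FreeMonoid.lift_eval_of]
    · split_ifs <;> rfl
    · exact mul_comm _ _)

theorem belowIndicator_σ (m k : ℕ) [Decidable (k < m)] :
    belowIndicator m (σ k) = if k < m then 1 else 0 := by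
  simp [belowIndicator, σ]

theorem belowIndicator_of_mem {m : ℕ} {x : PosBraid} (hx : x ∈ below m) :
    belowIndicator m x = 1 := by
  induction hx using Submonoid.closure_induction with
  | mem x hx =>
    obtain ⟨k, hk, rfl⟩ := hx
    rw [belowIndicator_σ, if_pos (Set.mem_Iio.1 hk)]
  | one => exact map_one _
  | mul x y _ _ hx hy => rw [map_mul, hx, hy]

theorem lt_of_σ_dvd {m k : ℕ} {x : PosBraid} (hx : x ∈ below m) (h : σ k ∣ x) : k < m := by
  obtain ⟨y, rfl⟩ := h
  have := belowIndicator_of_mem hx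
  rw [map_mul, belowIndicator_σ] at this
  by_contra hk
  simp [hk] at this

theorem σ_comm_of_mem_below {m j : ℕ} (h : m + 1 ≤ j) {v : PosBraid} (hv : v ∈ below m) :
    σ j * v = v * σ j := by
  change Commute (σ j) v
  induction hv using Submonoid.closure_induction with
  | mem v hv =>
    obtain ⟨k, hk, rfl⟩ := hv
    have : k < m := hk
    exact σ_comm (Or.inr (by omega))
  | one => exact Commute.one_right _
  | mul v w _ _ hv hw => exact hv.mul_right hw

theorem σ_dvd_of_dvd_mul {m j : ℕ} (h : m + 1 ≤ j) {v : PosBraid} (hv : v ∈ below m)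
    {x : PosBraid} (hx : σ j ∣ v * x) : σ j ∣ x := by
  induction hv using Submonoid.closure_induction generalizing x with
  | mem v hv =>
    obtain ⟨k, hk, rfl⟩ := hv
    have : k < m := hk
    obtain ⟨y, hy⟩ := hx
    obtain ⟨c, hc, -⟩ := (factors_far (Or.inl (by omega))).1 (factors hy)
    exact ⟨c, hc⟩
  | one => simpa using hx
  | mul v w _ _ hv hw => exact hw (hv (by rwa [← mul_assoc]))

open Classical in
/-- The descending product `σ (m - 1) * σ (m - 2) * ⋯` over the maximal run of consecutive elements
of `E` that ends in `m - 1`. -/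
noncomputable def run (E : Set ℕ) : ℕ → PosBraid
  | 0 => 1
  | m + 1 => if m ∈ E then σ m * run E m else 1

/-- The least common right multiple of the generators with indices in `E` and below `m`. -/
noncomputable def lcm (E : Set ℕ) : ℕ → PosBraid
  | 0 => 1
  | m + 1 => lcm E m * run E (m + 1)

variable {E : Set ℕ}

theorem run_succ_of_mem {m : ℕ} (h : m ∈ E) : run E (m + 1) = σ m * run E m := by simp [run, h]

theorem run_succ_of_notMem {m : ℕ} (h : m ∉ E) : run E (m + 1) = 1 := by simp [run, h]

theorem run_mem_below (m : ℕ) : run E m ∈ below m := by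
  induction m with
  | zero => exact one_mem _
  | succ m ih =>
    by_cases h : m ∈ E
    · rw [run_succ_of_mem h]
      exact mul_mem (σ_mem_below (by omega)) (below_mono (by omega) ih)
    · rw [run_succ_of_notMem h]
      exact one_mem _

theorem lcm_mem_below (m : ℕ) : lcm E m ∈ below m := by
  induction m with
  | zero => exact one_mem _
  | succ m ih => exact mul_mem (below_mono (by omega) ih) (run_mem_below _)

theorem σ_mul_run_dvd {m : ℕ} {x : PosBraid} (h : σ m ∣ run E m * x) : σ m * run E m ∣ x := by
  induction m generalizing x with
  | zero => simpa [run] using h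
  | succ m ih =>
    by_cases hm : m ∈ E
    · rw [run_succ_of_mem hm] at h ⊢
      obtain ⟨y, hy⟩ := h
      rw [mul_assoc] at hy
      obtain ⟨c, hc, -⟩ := (factors_adj (Or.inl rfl)).1 (factors hy)
      obtain ⟨x, rfl⟩ := σ_dvd_of_dvd_mul le_rfl (run_mem_below m) ⟨_, hc⟩
      rw [← mul_assoc, ← σ_comm_of_mem_below le_rfl (run_mem_below m), mul_assoc] at hc
      exact mul_dvd_mul_left _ (ih ⟨_, mul_left_cancel_pos _ hc⟩)
    · rw [run_succ_of_notMem hm] at h ⊢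
      simpa using h

theorem lcm_dvd {m : ℕ} {x : PosBraid} (h : ∀ k ∈ E, k < m → σ k ∣ x) : lcm E m ∣ x := by
  induction m with
  | zero => exact one_dvd _
  | succ m ih =>
    obtain ⟨y, rfl⟩ := ih fun k hk hkm => h k hk (by omega)
    by_cases hm : m ∈ E
    · rw [lcm, run_succ_of_mem hm]
      refine mul_dvd_mul_left _ (σ_mul_run_dvd ?_)
      have := h m hm (by omega)
      cases m with
      | zero => exact this
      | succ m =>
        rw [lcm, mul_assoc] at this
        exact σ_dvd_of_dvd_mul le_rfl (lcm_mem_below m) this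
    · simp [lcm, run_succ_of_notMem hm]

theorem σ_mul_run_dvd_run (m : ℕ) : σ m * run E m ∣ run E m * (σ m * run E m) := by
  induction m with
  | zero => simp [run]
  | succ m ih =>
    by_cases hm : m ∈ E
    · obtain ⟨z, hz⟩ := ih
      refine ⟨σ (m + 1) * z, ?_⟩
      have hr : σ (m + 1) * run E m = run E m * σ (m + 1) :=
        σ_comm_of_mem_below le_rfl (run_mem_below m)
      have hb := σ_braid_mul (Or.inl rfl : Adj m (m + 1)) (run E m * z)
      rw [run_succ_of_mem hm]
      calc σ m * run E m * (σ (m + 1) * (σ m * run E m))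
          = σ m * (run E m * σ (m + 1)) * (σ m * run E m) := by simp only [mul_assoc]
        _ = σ m * (σ (m + 1) * (run E m * (σ m * run E m))) := by
            rw [← hr]; simp only [mul_assoc]
        _ = σ m * (σ (m + 1) * (σ m * (run E m * z))) := by rw [hz]; simp only [mul_assoc]
        _ = σ (m + 1) * (σ m * (σ (m + 1) * run E m * z)) := by rw [hb]; simp only [mul_assoc]
        _ = σ (m + 1) * (σ m * run E m) * (σ (m + 1) * z) := by rw [hr]; simp only [mul_assoc]
    · simp [run_succ_of_notMem hm]

theorem σ_dvd_lcm {k m : ℕ} (hk : k ∈ E) (h : k < m) : σ k ∣ lcm E m := by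
  induction m with
  | zero => omega
  | succ m ih =>
    rcases Nat.lt_succ_iff_lt_or_eq.1 h with h | rfl
    · exact (ih h).trans (Dvd.intro _ rfl)
    · rw [lcm, run_succ_of_mem hk]
      have := (Dvd.intro _ rfl : σ k ∣ _).trans (σ_mul_run_dvd_run (E := E) k)
      cases k with
      | zero => simp [lcm]
      | succ k =>
        rw [lcm, mul_assoc]
        obtain ⟨z, hz⟩ := this
        rw [hz, ← mul_assoc, ← σ_comm_of_mem_below le_rfl (lcm_mem_below k), mul_assoc]
        exact Dvd.intro _ rfl

theorem exists_run_eq_mul_σ {m : ℕ} (h : m ∈ E) :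
    ∃ s ∈ E, s ≤ m ∧ ∃ z, run E (m + 1) = z * σ s := by
  induction m with
  | zero => exact ⟨0, h, le_rfl, 1, by simp [run, h]⟩
  | succ m ih =>
    rw [run_succ_of_mem h]
    by_cases hm : m ∈ E
    · obtain ⟨s, hs, hsm, z, hz⟩ := ih hm
      exact ⟨s, hs, by omega, σ (m + 1) * z, by rw [hz, mul_assoc]⟩
    · exact ⟨m + 1, h, le_rfl, 1, by simp [run_succ_of_notMem hm]⟩

open Classical in
theorem lcm_eq_prod_or (m : ℕ) :
    ((∀ k, k + 1 < m → k ∈ E → k + 1 ∉ E) ∧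
      lcm E m = (((List.range m).filter (· ∈ E)).map σ).prod) ∨
    ∃ s ∈ E, s < m ∧ ∃ z, lcm E m = σ s * z * σ s := by
  induction m with
  | zero => exact .inl ⟨by simp, by simp [lcm]⟩
  | succ m ih =>
    by_cases hm : m ∈ E
    · cases m with
      | zero => exact .inl ⟨by simp, by simp [lcm, run, hm, List.range_succ]⟩
      | succ m =>
        by_cases hm' : m ∈ E
        · obtain ⟨s, hs, hsm, z, hz⟩ := exists_run_eq_mul_σ hm'
          obtain ⟨y, hy⟩ := σ_dvd_lcm (m := m + 1) hs (by omega)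
          refine .inr ⟨s, hs, by omega, y * (σ (m + 1) * z), ?_⟩
          rw [lcm, run_succ_of_mem hm, hz, hy]
          simp only [mul_assoc]
        · rw [lcm, run_succ_of_mem hm, run_succ_of_notMem hm', mul_one]
          rcases ih with ⟨h₁, h₂⟩ | ⟨s, hs, hsm, z, hz⟩
          · refine .inl ⟨fun k hk hkE => ?_, ?_⟩
            · rcases eq_or_ne k m with rfl | hne
              · exact absurd hkE hm'
              · exact h₁ k (by omega) hkE
            · rw [List.range_succ, h₂]
              simp [hm]
          · have hne : s ≠ m := by rintro rfl; exact hm' hs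
            refine .inr ⟨s, hs, by omega, z * σ (m + 1), ?_⟩
            rw [hz, mul_assoc, σ_comm (Or.inl (by omega))]
            simp only [mul_assoc]
    · rw [lcm, run_succ_of_notMem hm, mul_one]
      rcases ih with ⟨h₁, h₂⟩ | ⟨s, hs, hsm, z, hz⟩
      · refine .inl ⟨fun k hk hkE => ?_, ?_⟩
        · rcases eq_or_ne (k + 1) m with rfl | hne
          · exact hm
          · exact h₁ k (by omega) hkE
        · rw [List.range_succ, h₂]
          simp [hm]
      · exact .inr ⟨s, hs, by omega, z, hz⟩

/-- A positive palindrome all of whose initial letters have index below `m` either starts and ends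
in the same letter, or is a product of pairwise commuting generators. -/
theorem palindrome_cases {m : ℕ} {x : PosBraid} (hx : rev x = x) (hm : ∀ k, σ k ∣ x → k < m) :
    (∃ s z, x = σ s * z * σ s) ∨
      ∃ L : List ℕ, L.Pairwise (fun i j => i + 2 ≤ j) ∧ x = (L.map σ).prod := by
  obtain ⟨w, hw⟩ := lcm_dvd (E := {k | σ k ∣ x}) (m := m) fun k hk _ => hk
  rcases eq_one_or_exists_mul_σ w with rfl | ⟨v, s, rfl⟩
  · rw [mul_one] at hw
    rcases lcm_eq_prod_or (E := {k | σ k ∣ x}) m with ⟨h₁, h₂⟩ | ⟨s, -, -, z, hz⟩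
    · refine .inr ⟨_, ?_, hw.trans h₂⟩
      refine (List.pairwise_filter.2 ?_)
      refine List.pairwise_lt_range.imp_of_mem fun {i j} hi hj hij hi' hj' => ?_
      simp only [decide_eq_true_eq, List.mem_range] at hi hj hi' hj'
      by_contra hlt
      obtain rfl : j = i + 1 := by omega
      exact h₁ i hj hi' hj'
    · exact .inl ⟨s, z, hw.trans hz⟩
  · have hs : σ s ∣ x := by
      rw [← hx, hw]
      simp only [rev_mul, rev_σ, mul_assoc]
      exact Dvd.intro _ rfl
    obtain ⟨y, hy⟩ := σ_dvd_lcm (E := {k | σ k ∣ x}) hs (hm s hs)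
    refine .inl ⟨s, y * v, ?_⟩
    rw [hw, hy]
    simp only [mul_assoc]

/-- Every positive palindrome is a conjugate `y * D * rev y` of a product of pairwise commuting
generators. -/
theorem exists_palindrome_decomposition {x : PosBraid} (hx : rev x = x) :
    ∃ y, ∃ L : List ℕ, L.Pairwise (fun i j => i + 2 ≤ j) ∧ x = y * (L.map σ).prod * rev y := by
  obtain ⟨l, hl⟩ : ∃ l, length x = l := ⟨_, rfl⟩
  induction l using Nat.strong_induction_on generalizing x with
  | _ l ih =>
    obtain ⟨m, hm⟩ := exists_mem_below x
    rcases palindrome_cases hx fun k => lt_of_σ_dvd hm with ⟨s, z, rfl⟩ | ⟨L, hL, h⟩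
    · simp only [rev_mul, rev_σ, ← mul_assoc] at hx
      have hz : rev z = z := by
        rw [mul_assoc, mul_assoc] at hx
        exact mul_right_cancel_pos _ (mul_left_cancel_pos _ hx)
      simp only [length_mul, length_σ] at hl
      obtain ⟨y, L, hL, h⟩ := ih _ (by omega) hz rfl
      refine ⟨σ s * y, L, hL, ?_⟩
      rw [rev_mul, rev_σ]
      nth_rewrite 1 [h]
      simp only [mul_assoc]
    · exact ⟨1, L, hL, by simpa using h⟩

theorem lcm_univ_dvd_mul {m : ℕ} {x : PosBraid} (hx : x ∈ below m) :
    lcm Set.univ m ∣ x * lcm Set.univ m := by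
  induction hx using Submonoid.closure_induction with
  | mem x hx =>
    obtain ⟨k, hk, rfl⟩ := hx
    have hk : k < m := hk
    refine lcm_dvd fun j _ hj => ?_
    obtain ⟨a, ha⟩ := σ_dvd_lcm (Set.mem_univ k) hk
    obtain ⟨b, hb⟩ := σ_dvd_lcm (Set.mem_univ j) hj
    rcases eq_or_adj_or_far k j with rfl | h | h
    · exact Dvd.intro _ rfl
    · obtain ⟨c, -, hc⟩ := (factors_adj h).1 (factors (ha.symm.trans hb))
      rw [hb, hc, ← σ_braid_mul h.symm, ← σ_braid_mul h]
      exact ⟨_, σ_braid_mul h _⟩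
    · rw [hb, σ_comm_mul h]
      exact Dvd.intro _ rfl
  | one => simp
  | mul x y _ _ hx hy =>
    obtain ⟨z, hz⟩ := hy
    rw [mul_assoc, hz, ← mul_assoc]
    exact hx.trans (Dvd.intro _ rfl)

theorem exists_mul_eq_mul (x y : PosBraid) : ∃ u v, x * u = y * v := by
  induction x using PosBraid.induction_left generalizing y with
  | one => exact ⟨y, 1, by simp⟩
  | mul i x ih =>
    obtain ⟨m, hm⟩ := exists_mem_below y
    have hm' : y ∈ below (max m (i + 1)) := below_mono (le_max_left _ _) hm
    obtain ⟨a, ha⟩ := (σ_dvd_lcm (Set.mem_univ i) (by simp)).trans (lcm_univ_dvd_mul hm')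
    obtain ⟨u, v, huv⟩ := ih a
    refine ⟨u, lcm Set.univ (max m (i + 1)) * v, ?_⟩
    rw [mul_assoc, huv, ← mul_assoc, ← ha, mul_assoc]

theorem exists_mul_eq_mul' (x y : PosBraid) : ∃ u v, u * x = v * y := by
  obtain ⟨u, v, h⟩ := exists_mul_eq_mul (rev x) (rev y)
  exact ⟨rev u, rev v, by simpa using congrArg rev h⟩

noncomputable instance : OreLocalization.OreSet (⊤ : Submonoid PosBraid) where
  ore_right_cancel _ _ s h := ⟨1, by rw [mul_right_cancel_pos _ h]⟩
  oreNum x y := (exists_mul_eq_mul' x y).choose_spec.choose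
  oreDenom x y := ⟨(exists_mul_eq_mul' x y).choose, trivial⟩
  ore_eq x y := (exists_mul_eq_mul' x y).choose_spec.choose_spec

/-- The monoid of fractions of the positive braid monoid. -/
abbrev Fraction : Type := OreLocalization (⊤ : Submonoid PosBraid) PosBraid

/-- The embedding of the positive braid monoid into the units of its monoid of fractions. -/
noncomputable def toFraction (x : PosBraid) : Fractionˣ :=
  OreLocalization.numeratorUnit (⟨x, trivial⟩ : (⊤ : Submonoid PosBraid))

theorem toFraction_val (x : PosBraid) :
    (toFraction x : Fraction) = OreLocalization.numeratorHom x := rfl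

theorem toFraction_one : toFraction 1 = 1 := by
  ext
  rw [toFraction_val, map_one, Units.val_one]

theorem toFraction_mul (x y : PosBraid) : toFraction (x * y) = toFraction x * toFraction y := by
  ext
  rw [toFraction_val, map_mul, Units.val_mul, toFraction_val, toFraction_val]

theorem toFraction_injective : Function.Injective toFraction := by
  intro x y h
  have h := congrArg Units.val h
  rw [toFraction_val, toFraction_val, OreLocalization.numeratorHom_apply,
    OreLocalization.numeratorHom_apply, OreLocalization.oreDiv_eq_iff] at h
  obtain ⟨u, v, h₁, h₂⟩ := h
  simp only [OneMemClass.coe_one, mul_one] at h₂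
  rw [← h₂] at h₁
  exact (mul_left_cancel_pos _ h₁).symm

open Classical in
/-- The homomorphism to the braid group on `n` strands with a zero adjoined that sends the
generators not belonging to the braid group to zero. -/
noncomputable def toBraid (n : ℕ) : PosBraid →* WithZero (BraidGroup n) :=
  PresentedMonoid.lift
    (fun k => if h : k < n - 1 then ((braidGen ⟨k, h⟩ : BraidGroup n) : WithZero (BraidGroup n))
      else 0) (by
    rintro _ _ (⟨i⟩ | ⟨i, j, h⟩) <;> simp only [map_mul, FreeMonoid.lift_eval_of]
    · by_cases h : i + 1 < n - 1
      · have hi : i < n - 1 := by omega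
        simp only [h, hi, dite_true]
        norm_cast
        exact PresentedGroup.mk_eq_mk_of_mul_inv_mem ⟨⟨i, hi⟩, ⟨i + 1, h⟩, .inl ⟨rfl, rfl⟩⟩
      · simp [h]
    · by_cases hj : j < n - 1
      · have hi : i < n - 1 := by omega
        simp only [hj, hi, dite_true]
        norm_cast
        exact PresentedGroup.mk_eq_mk_of_mul_inv_mem ⟨⟨i, hi⟩, ⟨j, hj⟩, .inr ⟨h, rfl⟩⟩
      · simp [hj])

theorem toBraid_σ {n k : ℕ} (h : k < n - 1) :
    toBraid n (σ k) = (braidGen ⟨k, h⟩ : BraidGroup n) := by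
  simp [toBraid, σ, h]

theorem toBraid_σ_eq_zero {n k : ℕ} (h : ¬ k < n - 1) : toBraid n (σ k) = 0 := by
  simp [toBraid, σ, h]

/-- The homomorphism from the braid group on `n` strands to the group of fractions of the positive
braid monoid. -/
noncomputable def ofBraid (n : ℕ) : BraidGroup n →* Fractionˣ :=
  PresentedGroup.toGroup (f := fun i : Fin (n - 1) => toFraction (σ i)) (by
    rintro _ ⟨i, j, ⟨h, rfl⟩ | ⟨h, rfl⟩⟩ <;>
      simp only [map_mul, map_inv, FreeGroup.lift_apply_of, mul_inv_eq_one, ← toFraction_mul]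
    · rw [σ_braid (Or.inl h)]
    · rw [σ_comm (Or.inl h)])

theorem ofBraid_braidGen {n : ℕ} (i : Fin (n - 1)) :
    ofBraid n (braidGen i) = toFraction (σ i) := PresentedGroup.toGroup.of _

section Reversal

variable {n : ℕ} {rev' : BraidGroup n → BraidGroup n}

theorem exists_lift (h_one : rev' 1 = 1) (hmul : ∀ x y, rev' (x * y) = rev' y * rev' x)
    (hgen : ∀ i : Fin (n - 1), rev' (braidGen i) = braidGen i) {x : BraidGroup n}
    (hx : x ∈ Submonoid.closure (Set.range (braidGen (n := n)))) :
    ∃ w, toBraid n w = x ∧ ofBraid n x = toFraction w ∧ ofBraid n (rev' x) = toFraction (rev w) := by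
  induction hx using Submonoid.closure_induction with
  | mem x hx =>
    obtain ⟨i, rfl⟩ := hx
    refine ⟨σ i, toBraid_σ i.2, ofBraid_braidGen i, ?_⟩
    rw [hgen, ofBraid_braidGen, rev_σ]
  | one => exact ⟨1, by simp, by rw [map_one, toFraction_one],
      by rw [h_one, map_one, rev_one, toFraction_one]⟩
  | mul x y _ _ hx hy =>
    obtain ⟨v, hv₁, hv₂, hv₃⟩ := hx
    obtain ⟨w, hw₁, hw₂, hw₃⟩ := hy
    refine ⟨v * w, ?_, ?_, ?_⟩
    · rw [map_mul, hv₁, hw₁, WithZero.coe_mul]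
    · rw [map_mul, hv₂, hw₂, toFraction_mul]
    · rw [hmul, map_mul, hv₃, hw₃, rev_mul, toFraction_mul]

theorem exists_toBraid_eq (h_one : rev' 1 = 1) (hmul : ∀ x y, rev' (x * y) = rev' y * rev' x)
    (hgen : ∀ i : Fin (n - 1), rev' (braidGen i) = braidGen i) {w : PosBraid}
    (hw : toBraid n w ≠ 0) :
    ∃ y ∈ Submonoid.closure (Set.range (braidGen (n := n))),
      toBraid n w = y ∧ toBraid n (rev w) = (rev' y : BraidGroup n) := by
  induction w using PosBraid.induction_left with
  | one => exact ⟨1, one_mem _, by simp, by simp [h_one]⟩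
  | mul i w ih =>
    rw [map_mul] at hw
    obtain ⟨y, hy, hy₁, hy₂⟩ := ih (right_ne_zero_of_mul hw)
    have hi : i < n - 1 := by
      by_contra hi
      exact left_ne_zero_of_mul hw (toBraid_σ_eq_zero hi)
    refine ⟨braidGen ⟨i, hi⟩ * y, mul_mem (Submonoid.subset_closure ⟨_, rfl⟩) hy, ?_, ?_⟩
    · rw [map_mul, hy₁, toBraid_σ hi, WithZero.coe_mul]
    · rw [rev_mul, map_mul, hy₂, rev_σ, toBraid_σ hi, hmul, hgen, WithZero.coe_mul]

theorem exists_toBraid_prod_eq {L : List ℕ} (hL : toBraid n (L.map σ).prod ≠ 0) :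
    ∃ L' : List (Fin (n - 1)), L'.map Fin.val = L ∧
      toBraid n (L.map σ).prod = ((L'.map braidGen).prod : BraidGroup n) := by
  induction L with
  | nil => exact ⟨[], rfl, by simp⟩
  | cons i L ih =>
    rw [List.map_cons, List.prod_cons, map_mul] at hL
    obtain ⟨L', rfl, h⟩ := ih (right_ne_zero_of_mul hL)
    have hi : i < n - 1 := by
      by_contra hi
      exact left_ne_zero_of_mul hL (toBraid_σ_eq_zero hi)
    refine ⟨⟨i, hi⟩ :: L', rfl, ?_⟩
    rw [List.map_cons, List.prod_cons, map_mul, h, toBraid_σ hi, List.map_cons, List.prod_cons,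
      WithZero.coe_mul]

end Reversal

end PosBraid

/-- Let `n ≥ 2` and let `B n⁺` be the submonoid of `B n` generated by the
`σ i`.  Every palindrome `x ∈ B n⁺` can be written as `x = y * (∏_{i ∈ I} σ i) * rev y` with
`y ∈ B n⁺` and `I` a set of indices that are pairwise at distance `≥ 2` (so that the
generators `σ i`, `i ∈ I`, pairwise commute; the product is taken in increasing order). -/
theorem positive_palindrome_decomposition
    (n : ℕ) (hn : 2 ≤ n)
    (rev : BraidGroup n → BraidGroup n)
    (hmul : ∀ x y, rev (x * y) = rev y * rev x)
    (hinv : ∀ x, rev (rev x) = x)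
    (hgen : ∀ i : Fin (n - 1), rev (braidGen i) = braidGen i)
    (x : BraidGroup n)
    (hx : x ∈ Submonoid.closure (Set.range (braidGen (n := n))))
    (hpal : rev x = x) :
    ∃ y ∈ Submonoid.closure (Set.range (braidGen (n := n))),
      ∃ I : Finset (Fin (n - 1)),
        (∀ i ∈ I, ∀ j ∈ I, i ≠ j → ((i : ℕ) + 2 ≤ (j : ℕ) ∨ (j : ℕ) + 2 ≤ (i : ℕ))) ∧
        x = y * ((I.sort (· ≤ ·)).map braidGen).prod * rev y := by
  have h_one : rev 1 = 1 := by simpa using hmul 1 1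
  obtain ⟨w, hw, hw₁, hw₂⟩ := PosBraid.exists_lift h_one hmul hgen hx
  rw [hpal, hw₁] at hw₂
  obtain ⟨y, L, hL, rfl⟩ :=
    PosBraid.exists_palindrome_decomposition (PosBraid.toFraction_injective hw₂).symm
  have h_ne : PosBraid.toBraid n (y * (L.map PosBraid.σ).prod * PosBraid.rev y) ≠ 0 := by
    rw [hw]
    exact WithZero.coe_ne_zero
  rw [map_mul, map_mul] at h_ne hw
  obtain ⟨z, hz, hz₁, hz₂⟩ := PosBraid.exists_toBraid_eq h_one hmul hgen
    (left_ne_zero_of_mul (left_ne_zero_of_mul h_ne))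
  obtain ⟨L', rfl, hL'⟩ := PosBraid.exists_toBraid_prod_eq
    (right_ne_zero_of_mul (left_ne_zero_of_mul h_ne))
  rw [List.pairwise_map] at hL
  have hlt : L'.Pairwise (· < ·) := hL.imp fun {i j} h => Fin.lt_def.2 (by omega)
  refine ⟨z, hz, L'.toFinset, ?_, ?_⟩
  · intro i hi j hj hij
    rw [List.mem_toFinset] at hi hj
    have : Std.Symm fun i j : Fin (n - 1) => (i : ℕ) + 2 ≤ j ∨ (j : ℕ) + 2 ≤ i :=
      ⟨fun _ _ => Or.symm⟩
    exact (hL.imp fun h => Or.inl h : L'.Pairwise fun i j : Fin (n - 1) =>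
      (i : ℕ) + 2 ≤ j ∨ (j : ℕ) + 2 ≤ i).forall hi hj hij
  · rw [(List.toFinset_sort (· ≤ ·) hlt.nodup).2 (hlt.imp le_of_lt)]
    rw [hz₁, hz₂, hL'] at hw
    exact_mod_cast hw.symm
end

section
/- For every n ≥ 2 and every 1 ≤ i ≤ n−1, conjugation by the Garside element satisfies Δ n⁻¹ * σ i * Δ n = σ (n−i) in the braid group B n. -/
/-- `braidGen' n k` is `σ_{k+1}` for `k < n - 1` and `1` otherwise. -/
def braidGen' (n : ℕ) (k : ℕ) : BraidGroup n :=
  if h : k < n - 1 then braidGen ⟨k, h⟩ else 1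

/-- `braidAsc n m = σ₁ σ₂ ⋯ σ_m`. -/
def braidAsc (n m : ℕ) : BraidGroup n := ((List.range m).map (braidGen' n)).prod

/-- The Garside element `Δ n = (σ₁ ⋯ σ_{n-1}) (σ₁ ⋯ σ_{n-2}) ⋯ (σ₁ σ₂) (σ₁)`,
the closed form of the recursion `Δ 2 = σ₁`, `Δ n = σ₁ σ₂ ⋯ σ_{n-1} * Δ (n-1)`. -/
def garside (n : ℕ) : BraidGroup n :=
  ((List.range (n - 1)).map (fun j => braidAsc n (n - 1 - j))).prod

theorem braidGen'_of_lt {n k : ℕ} (h : k < n - 1) : braidGen' n k = braidGen ⟨k, h⟩ :=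
  dif_pos h

theorem braidGen'_braid {n k : ℕ} (h : k + 1 < n - 1) :
    braidGen' n k * braidGen' n (k + 1) * braidGen' n k =
      braidGen' n (k + 1) * braidGen' n k * braidGen' n (k + 1) := by
  rw [braidGen'_of_lt h, braidGen'_of_lt (Nat.lt_of_succ_lt h)]
  exact PresentedGroup.mk_eq_mk_of_mul_inv_mem
    ⟨⟨k, Nat.lt_of_succ_lt h⟩, ⟨k + 1, h⟩, Or.inl ⟨rfl, rfl⟩⟩

theorem braidGen'_commute {n i j : ℕ} (hij : i + 2 ≤ j) :
    Commute (braidGen' n i) (braidGen' n j) := by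
  by_cases hj : j < n - 1
  · have hi : i < n - 1 := by omega
    rw [braidGen'_of_lt hi, braidGen'_of_lt hj]
    exact PresentedGroup.mk_eq_mk_of_mul_inv_mem ⟨⟨i, hi⟩, ⟨j, hj⟩, Or.inr ⟨hij, rfl⟩⟩
  · rw [show braidGen' n j = 1 from dif_neg hj]
    exact Commute.one_right _

theorem braidAsc_succ (n m : ℕ) : braidAsc n (m + 1) = braidAsc n m * braidGen' n m :=
  List.prod_range_succ _ _

theorem braidAsc_commute {n m j : ℕ} (h : m + 1 ≤ j) :
    Commute (braidAsc n m) (braidGen' n j) := by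
  induction m with
  | zero => exact Commute.one_left _
  | succ m ih =>
    rw [braidAsc_succ]
    exact (ih (by omega)).mul_left (braidGen'_commute (by omega))

/-- Moving a generator across `σ₁ ⋯ σ_m` shifts its index by one. -/
theorem braidAsc_mul_braidGen' {n m i : ℕ} (hm : m ≤ n - 1) (hi : i + 1 < m) :
    braidAsc n m * braidGen' n i = braidGen' n (i + 1) * braidAsc n m := by
  induction m with
  | zero => omega
  | succ m ih =>
    rcases Nat.lt_or_ge (i + 1) m with h | h
    · rw [braidAsc_succ, mul_assoc, ← (braidGen'_commute (n := n) (i := i) (j := m) h).eq,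
        ← mul_assoc, ih (by omega) h, mul_assoc]
    · obtain rfl : m = i + 1 := by omega
      calc braidAsc n (i + 1 + 1) * braidGen' n i
          = braidAsc n i * (braidGen' n i * braidGen' n (i + 1) * braidGen' n i) := by
            simp only [braidAsc_succ, mul_assoc]
        _ = braidAsc n i * braidGen' n (i + 1) * (braidGen' n i * braidGen' n (i + 1)) := by
            rw [braidGen'_braid (by omega)]
            simp only [mul_assoc]
        _ = braidGen' n (i + 1) * braidAsc n (i + 1 + 1) := by
            rw [(braidAsc_commute le_rfl).eq]
            simp only [braidAsc_succ, mul_assoc]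

theorem braidGen'_zero_mul_braidAsc_mul_braidAsc {n m j : ℕ} (hm : m ≤ n - 1) (hj : j < m) :
    braidGen' n 0 * braidAsc n m * braidAsc n j = braidAsc n (j + 1) * braidAsc n m := by
  induction j with
  | zero => simp [braidAsc]
  | succ j ih =>
    rw [braidAsc_succ n j, ← mul_assoc, ih (by omega), mul_assoc, braidAsc_mul_braidGen' hm hj,
      ← mul_assoc, ← braidAsc_succ]

/-- The Garside element of the first `m + 1` strands, inside the braid group on `n` strands. -/
def partialGarside (n m : ℕ) : BraidGroup n :=
  ((List.range m).map (fun j => braidAsc n (m - j))).prod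

theorem partialGarside_succ (n m : ℕ) :
    partialGarside n (m + 1) = braidAsc n (m + 1) * partialGarside n m := by
  simp [partialGarside, List.prod_range_succ']

theorem partialGarside_commute {n m j : ℕ} (h : m + 1 ≤ j) :
    Commute (partialGarside n m) (braidGen' n j) := by
  induction m with
  | zero => exact Commute.one_left _
  | succ m ih =>
    rw [partialGarside_succ]
    exact (braidAsc_commute h).mul_left (ih (by omega))

theorem braidGen'_zero_mul_partialGarside {n m : ℕ} (hm : m + 1 ≤ n - 1) :
    braidGen' n 0 * partialGarside n (m + 1) = partialGarside n (m + 1) * braidGen' n m := by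
  cases m with
  | zero => simp [partialGarside, braidAsc]
  | succ m =>
    rw [partialGarside_succ, partialGarside_succ, ← mul_assoc, ← mul_assoc,
      braidGen'_zero_mul_braidAsc_mul_braidAsc hm (Nat.lt_succ_self _), mul_assoc, mul_assoc,
      mul_assoc, (partialGarside_commute le_rfl).eq, braidAsc_succ n (m + 1)]
    simp only [mul_assoc]

theorem braidGen'_mul_partialGarside {n m i : ℕ} (hm : m ≤ n - 1) (hi : i < m) :
    braidGen' n i * partialGarside n m = partialGarside n m * braidGen' n (m - 1 - i) := by
  induction m generalizing i with
  | zero => omega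
  | succ m ih =>
    cases i with
    | zero => exact braidGen'_zero_mul_partialGarside hm
    | succ i =>
      rw [partialGarside_succ, ← mul_assoc, ← braidAsc_mul_braidGen' hm hi, mul_assoc,
        ih (by omega) (by omega), ← mul_assoc, show m + 1 - 1 - (i + 1) = m - 1 - i by omega]

/-- For every `n ≥ 2` and every generator `σ i` of `B n` (here `i : Fin (n-1)`
corresponds to the classical generator with index `i+1 ∈ {1, …, n-1}`), conjugation by the
Garside element satisfies `Δₙ⁻¹ σ_{i+1} Δₙ = σ_{n-(i+1)}`. -/
theorem garside_conj_gen (n : ℕ) (hn : 2 ≤ n) (i : Fin (n - 1)) :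
    (garside n)⁻¹ * braidGen i * garside n =
      braidGen (⟨n - 2 - (i : ℕ), by have := i.isLt; omega⟩ : Fin (n - 1)) := by
  have h := braidGen'_mul_partialGarside (le_refl (n - 1)) i.isLt
  rw [braidGen'_of_lt i.isLt, show n - 1 - 1 - (i : ℕ) = n - 2 - i by omega,
    braidGen'_of_lt (by omega)] at h
  rw [mul_assoc, inv_mul_eq_iff_eq_mul]
  exact h
end
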